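/- Let κ, p, γ ∈ ℝ and set β = p − (κ+4)γ/2 + κγ², A(γ) = −(κ/2)γ² + γ + p, and C(γ) = −(κ/2)γ(γ−1) + 2γ − p. Define on 𝔻 × 𝔻 the function ψ(z,w) = (1−zw)^{−β} (1−z)^γ (1−w)^γ (principal-branch powers) and x = x(z,w) = (1−z)(1−w). Then for all (z,w) ∈ 𝔻 × 𝔻, 𝒫(D)ψ = ψ · x^{−1} · [C(γ)·(1−zw)/x − A(γ)] · (1−zw − x). In particular, if A(γ) = 0 then 𝒫(D)ψ = ψ · C(γ) · (1−zw)(1−zw−x) x^{−2}, which vanishes identically exactly when C(γ) = 0. -/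

import Mathlib

open Complex Metric Set

/-- `z ∂_z` acting on functions of two complex variables. -/
noncomputable def dZ (F : ℂ → ℂ → ℂ) : ℂ → ℂ → ℂ :=
  fun z w => z * deriv (fun t => F t w) z

/-- `w ∂_w` acting on functions of two complex variables. -/
noncomputable def dW (F : ℂ → ℂ → ℂ) : ℂ → ℂ → ℂ :=
  fun z w => w * deriv (fun t => F z t) w

/-- The interior Beliaev–Smirnov operator `𝒫(D)`. -/
noncomputable def BSop (κ p : ℝ) (F : ℂ → ℂ → ℂ) : ℂ → ℂ → ℂ :=
  fun z w =>
    -((κ : ℂ)/2) * (dZ (fun u v => dZ F u v - dW F u v) z w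
        - dW (fun u v => dZ F u v - dW F u v) z w)
      + ((z + 1)/(z - 1)) * dZ F z w
      + ((w + 1)/(w - 1)) * dW F z w
      - (p : ℂ) * (1/(z - 1)^2 + 1/(w - 1)^2 - 2) * F z w

/-- The function `(1 - zw)^b (1 - z)^g (1 - w)^g` with principal-branch powers. -/
noncomputable def powerKernel (b g : ℂ) (z w : ℂ) : ℂ :=
  (1 - z*w) ^ b * (1 - z) ^ g * (1 - w) ^ g

lemma powerKernel_comm (b g z w : ℂ) : powerKernel b g z w = powerKernel b g w z := by
  unfold powerKernel
  rw [mul_comm z w]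
  ring

lemma mul_mem_unit_ball {z w : ℂ} (hz : z ∈ ball (0 : ℂ) 1) (hw : w ∈ ball (0 : ℂ) 1) :
    z * w ∈ ball (0 : ℂ) 1 := by
  rw [mem_ball_zero_iff] at *
  rw [norm_mul]
  exact mul_lt_one_of_nonneg_of_lt_one_left (norm_nonneg _) hz hw.le

lemma one_sub_mem_slitPlane_of_mem_unit_ball {z : ℂ} (hz : z ∈ ball (0 : ℂ) 1) :
    1 - z ∈ slitPlane := by
  rw [mem_ball_zero_iff] at hz
  left
  have := (re_le_norm z).trans_lt hz
  simpa using this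

lemma one_sub_ne_zero_of_mem_unit_ball {z : ℂ} (hz : z ∈ ball (0 : ℂ) 1) : 1 - z ≠ 0 :=
  slitPlane_ne_zero (one_sub_mem_slitPlane_of_mem_unit_ball hz)

lemma powerKernel_ne_zero (b g : ℂ) {z w : ℂ} (hz : z ∈ ball (0 : ℂ) 1)
    (hw : w ∈ ball (0 : ℂ) 1) : powerKernel b g z w ≠ 0 := by
  have h1 := one_sub_ne_zero_of_mem_unit_ball hz
  have h2 := one_sub_ne_zero_of_mem_unit_ball hw
  have h3 := one_sub_ne_zero_of_mem_unit_ball (mul_mem_unit_ball hz hw)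
  unfold powerKernel
  simp [cpow_eq_zero_iff, h1, h2, h3]

lemma hasDerivAt_powerKernel_left (b g : ℂ) {z w : ℂ} (hz : z ∈ ball (0 : ℂ) 1)
    (hw : w ∈ ball (0 : ℂ) 1) :
    HasDerivAt (fun t => powerKernel b g t w)
      (powerKernel b g z w * (-(b * w) / (1 - z*w) - g / (1 - z))) z := by
  have h1 := one_sub_ne_zero_of_mem_unit_ball hz
  have h3 := one_sub_ne_zero_of_mem_unit_ball (mul_mem_unit_ball hz hw)
  have hd1 : HasDerivAt (fun t : ℂ => 1 - t*w) (-(1*w)) z :=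
    ((hasDerivAt_id z).mul_const w).const_sub 1
  have hd2 : HasDerivAt (fun t : ℂ => 1 - t) (-1) z := (hasDerivAt_id z).const_sub 1
  have hp1 := hd1.cpow_const (c := b)
    (one_sub_mem_slitPlane_of_mem_unit_ball (mul_mem_unit_ball hz hw))
  have hp2 := hd2.cpow_const (c := g) (one_sub_mem_slitPlane_of_mem_unit_ball hz)
  refine ((hp1.mul hp2).mul_const ((1 - w) ^ g)).congr_deriv ?_
  rw [cpow_sub _ _ h1, cpow_sub _ _ h3, cpow_one, cpow_one, powerKernel]
  field_simp
  ring

lemma hasDerivAt_powerKernel_right (b g : ℂ) {z w : ℂ} (hz : z ∈ ball (0 : ℂ) 1)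
    (hw : w ∈ ball (0 : ℂ) 1) :
    HasDerivAt (fun t => powerKernel b g z t)
      (powerKernel b g z w * (-(b * z) / (1 - z*w) - g / (1 - w))) w := by
  have h := hasDerivAt_powerKernel_left b g hw hz
  simp only [powerKernel_comm b g _ z] at h
  rwa [mul_comm w z] at h

lemma dZ_powerKernel (b g : ℂ) {z w : ℂ} (hz : z ∈ ball (0 : ℂ) 1)
    (hw : w ∈ ball (0 : ℂ) 1) :
    dZ (powerKernel b g) z w =
      z * (powerKernel b g z w * (-(b * w) / (1 - z*w) - g / (1 - z))) := by
  rw [dZ, (hasDerivAt_powerKernel_left b g hz hw).deriv]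

lemma dW_powerKernel (b g : ℂ) {z w : ℂ} (hz : z ∈ ball (0 : ℂ) 1)
    (hw : w ∈ ball (0 : ℂ) 1) :
    dW (powerKernel b g) z w =
      w * (powerKernel b g z w * (-(b * z) / (1 - z*w) - g / (1 - w))) := by
  rw [dW, (hasDerivAt_powerKernel_right b g hz hw).deriv]

lemma dZ_sub_dW_powerKernel (b g : ℂ) {z w : ℂ} (hz : z ∈ ball (0 : ℂ) 1)
    (hw : w ∈ ball (0 : ℂ) 1) :
    dZ (powerKernel b g) z w - dW (powerKernel b g) z w =
      powerKernel b g z w * (g * (1 / (1 - w) - 1 / (1 - z))) := by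
  have h1 := one_sub_ne_zero_of_mem_unit_ball hz
  have h2 := one_sub_ne_zero_of_mem_unit_ball hw
  rw [dZ_powerKernel b g hz hw, dW_powerKernel b g hz hw]
  field_simp
  ring

lemma hasDerivAt_one_div_one_sub {z : ℂ} (hz : 1 - z ≠ 0) :
    HasDerivAt (fun t : ℂ => 1 / (1 - t)) (1 / (1 - z) ^ 2) z := by
  have h := ((hasDerivAt_id z).const_sub 1).fun_inv hz
  simpa [one_div] using h

lemma dZ_dZ_sub_dW_powerKernel (b g : ℂ) {z w : ℂ} (hz : z ∈ ball (0 : ℂ) 1)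
    (hw : w ∈ ball (0 : ℂ) 1) :
    dZ (fun u v => dZ (powerKernel b g) u v - dW (powerKernel b g) u v) z w =
      dZ (powerKernel b g) z w * (g * (1 / (1 - w) - 1 / (1 - z)))
        - z * powerKernel b g z w * g / (1 - z) ^ 2 := by
  have h1 := one_sub_ne_zero_of_mem_unit_ball hz
  have hk := hasDerivAt_powerKernel_left b g hz hw
  have hm := ((hasDerivAt_one_div_one_sub h1).const_sub (1 / (1 - w))).const_mul g
  have hev : (fun t => dZ (powerKernel b g) t w - dW (powerKernel b g) t w) =ᶠ[nhds z]
      fun t => powerKernel b g t w * (g * (1 / (1 - w) - 1 / (1 - t))) := by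
    filter_upwards [isOpen_ball.mem_nhds hz] with t ht
    exact dZ_sub_dW_powerKernel b g ht hw
  rw [dZ, hev.deriv_eq, (hk.fun_mul hm).deriv, dZ, hk.deriv]
  ring

lemma dW_dZ_sub_dW_powerKernel (b g : ℂ) {z w : ℂ} (hz : z ∈ ball (0 : ℂ) 1)
    (hw : w ∈ ball (0 : ℂ) 1) :
    dW (fun u v => dZ (powerKernel b g) u v - dW (powerKernel b g) u v) z w =
      dW (powerKernel b g) z w * (g * (1 / (1 - w) - 1 / (1 - z)))
        + w * powerKernel b g z w * g / (1 - w) ^ 2 := by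
  have h2 := one_sub_ne_zero_of_mem_unit_ball hw
  have hk := hasDerivAt_powerKernel_right b g hz hw
  have hm := ((hasDerivAt_one_div_one_sub h2).sub_const (1 / (1 - z))).const_mul g
  have hev : (fun t => dZ (powerKernel b g) z t - dW (powerKernel b g) z t) =ᶠ[nhds w]
      fun t => powerKernel b g z t * (g * (1 / (1 - t) - 1 / (1 - z))) := by
    filter_upwards [isOpen_ball.mem_nhds hw] with t ht
    exact dZ_sub_dW_powerKernel b g hz ht
  rw [dW, hev.deriv_eq, (hk.fun_mul hm).deriv, dW, hk.deriv]
  ring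

lemma BSop_powerKernel (κ p : ℝ) (g : ℂ) {z w : ℂ} (hz : z ∈ ball (0 : ℂ) 1)
    (hw : w ∈ ball (0 : ℂ) 1) {b : ℂ} (hb : b = -(p - (κ + 4)*g/2 + κ*g^2)) :
    BSop κ p (powerKernel b g) z w =
      powerKernel b g z w * ((1 - z)*(1 - w))⁻¹
        * ((-(κ/2)*g*(g - 1) + 2*g - p) * (1 - z*w) / ((1 - z)*(1 - w))
          - (-(κ/2)*g^2 + g + p))
        * (1 - z*w - (1 - z)*(1 - w)) := by
  have h1 := one_sub_ne_zero_of_mem_unit_ball hz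
  have h2 := one_sub_ne_zero_of_mem_unit_ball hw
  have h3 := one_sub_ne_zero_of_mem_unit_ball (mul_mem_unit_ball hz hw)
  rw [BSop, dZ_dZ_sub_dW_powerKernel b g hz hw, dW_dZ_sub_dW_powerKernel b g hz hw,
    dZ_powerKernel b g hz hw, dW_powerKernel b g hz hw, ← neg_sub 1 z, ← neg_sub 1 w]
  generalize powerKernel b g z w = k
  rw [hb]
  field_simp
  ring

/-- With `β = p − (κ+4)γ/2 + κγ²`, `A(γ) = −(κ/2)γ² + γ + p`,
`C(γ) = −(κ/2)γ(γ−1) + 2γ − p`, `ψ(z,w) = (1−zw)^{−β}(1−z)^γ(1−w)^γ` and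
`x = (1−z)(1−w)`, one has on `𝔻 × 𝔻`
`𝒫(D)ψ = ψ · x⁻¹ · [C(γ)(1−zw)/x − A(γ)] · (1−zw−x)`; in particular if `A(γ) = 0` then
`𝒫(D)ψ = ψ · C(γ) · (1−zw)(1−zw−x) x⁻²`, which vanishes identically exactly when
`C(γ) = 0`. -/
theorem stmt8 (κ p γ : ℝ) :
    let β : ℝ := p - (κ + 4)*γ/2 + κ*γ^2
    let A : ℝ := -(κ/2)*γ^2 + γ + p
    let C : ℝ := -(κ/2)*γ*(γ - 1) + 2*γ - p
    let ψ : ℂ → ℂ → ℂ := fun z w =>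
      (1 - z*w) ^ (-(β : ℂ)) * (1 - z) ^ (γ : ℂ) * (1 - w) ^ (γ : ℂ)
    (∀ z ∈ ball (0:ℂ) 1, ∀ w ∈ ball (0:ℂ) 1,
      BSop κ p ψ z w =
        ψ z w * ((1 - z)*(1 - w))⁻¹
          * ((C : ℂ) * (1 - z*w) / ((1 - z)*(1 - w)) - (A : ℂ))
          * (1 - z*w - (1 - z)*(1 - w))) ∧
    (A = 0 →
      (∀ z ∈ ball (0:ℂ) 1, ∀ w ∈ ball (0:ℂ) 1,
        BSop κ p ψ z w =
          ψ z w * (C : ℂ) * (1 - z*w) * (1 - z*w - (1 - z)*(1 - w))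
            * (((1 - z)*(1 - w))⁻¹)^2) ∧
      ((∀ z ∈ ball (0:ℂ) 1, ∀ w ∈ ball (0:ℂ) 1, BSop κ p ψ z w = 0) ↔ C = 0)) := by
  intro β A C ψ
  have hψ : ψ = powerKernel (-(β : ℂ)) γ := rfl
  have hmain : ∀ z ∈ ball (0:ℂ) 1, ∀ w ∈ ball (0:ℂ) 1,
      BSop κ p ψ z w =
        ψ z w * ((1 - z)*(1 - w))⁻¹
          * ((C : ℂ) * (1 - z*w) / ((1 - z)*(1 - w)) - (A : ℂ))
          * (1 - z*w - (1 - z)*(1 - w)) := by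
    intro z hz w hw
    rw [hψ, BSop_powerKernel κ p γ hz hw (by simp [β] :
      -(β : ℂ) = -(p - (κ + 4)*γ/2 + κ*γ^2))]
    simp [A, C]
  have hzero : A = 0 → ∀ z ∈ ball (0:ℂ) 1, ∀ w ∈ ball (0:ℂ) 1,
      BSop κ p ψ z w =
        ψ z w * (C : ℂ) * (1 - z*w) * (1 - z*w - (1 - z)*(1 - w))
          * (((1 - z)*(1 - w))⁻¹)^2 := by
    intro hA z hz w hw
    rw [hmain z hz w hw, hA, ofReal_zero]
    ring
  refine ⟨hmain, fun hA => ⟨hzero hA, fun h => ?_, fun hC z hz w hw => ?_⟩⟩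
  · have hz : (1/2 : ℂ) ∈ ball (0:ℂ) 1 := by
      rw [mem_ball_zero_iff]
      norm_num
    have hw : (0 : ℂ) ∈ ball (0:ℂ) 1 := mem_ball_self one_pos
    have hk : ψ (1/2) 0 ≠ 0 := powerKernel_ne_zero _ _ hz hw
    have h0 := h _ hz _ hw
    rw [hzero hA _ hz _ hw] at h0
    norm_num [-one_div, hk] at h0
    simpa [hk] using h0
  · rw [hzero hA z hz w hw, hC, ofReal_zero]
    ring
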